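/- Nonexistence of a limiting classical randomization (conclusion of Example 2.1). There is no Borel measurable function m : ℝ → ℝ satisfying both 0 ≤ m(x) ≤ 1 for all x ∈ ℝ and ∫_ℝ m(x) · (2π)^{−1/2} e^{−(x−h)²/2} dx = e^{−h²/4} for every h ∈ ℝ. -/

import Mathlib

open MeasureTheory Real

lemma gaussianPDFReal_one_eq_rpow_mul_exp (h x : ℝ) :
    (2 * Real.pi) ^ (-(1 : ℝ) / 2) * Real.exp (-(x - h) ^ 2 / 2) =
      ProbabilityTheory.gaussianPDFReal h 1 x := by
  rw [ProbabilityTheory.gaussianPDFReal_def, neg_div, Real.rpow_neg (by positivity),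
    ← Real.sqrt_eq_rpow]
  simp

/-- A function bounded by `1` whose mean against a positive probability density is `1`
equals `1` almost everywhere. -/
lemma ae_eq_one_of_integral_mul_eq_one {α : Type*} [MeasurableSpace α] {μ : Measure α}
    {m φ : α → ℝ} (hle : ∀ x, m x ≤ 1) (hφ : ∀ x, 0 < φ x) (hφ_one : ∫ x, φ x ∂μ = 1)
    (hm : ∫ x, m x * φ x ∂μ = 1) : m =ᵐ[μ] 1 := by
  have hφi : Integrable φ μ := .of_integral_ne_zero (by simp [hφ_one])
  have hmi : Integrable (fun x => m x * φ x) μ := .of_integral_ne_zero (by simp [hm])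
  have hzero : ∫ x, (φ x - m x * φ x) ∂μ = 0 := by
    rw [integral_sub hφi hmi, hφ_one, hm, sub_self]
  have hnonneg : 0 ≤ fun x => φ x - m x * φ x := fun x => by
    simpa using mul_le_mul_of_nonneg_right (hle x) (hφ x).le
  filter_upwards [(integral_eq_zero_iff_of_nonneg hnonneg (hφi.sub hmi)).1 hzero] with x hx
  have hx' : 1 * φ x = m x * φ x := by simpa [sub_eq_zero] using hx
  exact (mul_right_cancel₀ (hφ x).ne' hx').symm

/-- **Nonexistence of a limiting classical randomization** (conclusion of Example 2.1).
There is no Borel measurable `m : ℝ → ℝ` with `0 ≤ m ≤ 1` pointwise whose Gaussian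
means equal `e^{-h²/4}` for every shift `h`. -/
theorem no_limiting_randomization :
    ¬ ∃ m : ℝ → ℝ, Measurable m ∧ (∀ x : ℝ, 0 ≤ m x ∧ m x ≤ 1) ∧
      (∀ h : ℝ,
        ∫ x : ℝ, m x * ((2 * Real.pi) ^ (-(1 : ℝ) / 2) * Real.exp (-(x - h) ^ 2 / 2)) =
          Real.exp (-h ^ 2 / 4)) := by
  rintro ⟨m, -, hm, H⟩
  simp only [gaussianPDFReal_one_eq_rpow_mul_exp] at H
  have hone := ae_eq_one_of_integral_mul_eq_one (fun x => (hm x).2)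
    (fun x => ProbabilityTheory.gaussianPDFReal_pos 0 1 x one_ne_zero)
    (ProbabilityTheory.integral_gaussianPDFReal_eq_one 0 one_ne_zero) (by simpa using H 0)
  have hmean : ∫ x, m x * ProbabilityTheory.gaussianPDFReal 1 1 x = 1 := by
    refine Eq.trans ?_ (ProbabilityTheory.integral_gaussianPDFReal_eq_one 1 one_ne_zero)
    refine integral_congr_ae ?_
    filter_upwards [hone] with x hx
    simp [hx]
  have hexp := (H 1).symm.trans hmean
  norm_num [Real.exp_eq_one_iff] at hexp
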